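/- arXiv:1710.05217 — 3 statements merged into one kernel-verified Lean document; each statement's English description precedes it below -/
import Mathlib

section
/- Let Ω ⊆ ℝⁿ be a Lebesgue measurable set with 0 < |Ω| < ∞, and let p(·), q(·) ∈ 𝒫(Ω) with p(·) not equal to 1 almost everywhere (equivalently p₊(Ω) > 1). Then there exist constants c₁ > 0 and c₂ ≥ 0 such that ∫_Ω (Mf(x))^{p(x)} dx ≤ c₁ ∫_Ω |f(x)|^{q(x)} dx + c₂ for every measurable function f on Ω if and only if p₊(Ω) ≤ q₋(Ω). -/
open MeasureTheory Set ENNReal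

noncomputable section

/-- The open axis-parallel cube with lower corner `a` and side length `s`. -/
def cube {n : ℕ} (a : Fin n → ℝ) (s : ℝ) : Set (Fin n → ℝ) :=
  Set.univ.pi fun i => Set.Ioo (a i) (a i + s)

/-- The uncentered Hardy–Littlewood maximal function: the supremum, over all open
axis-parallel cubes `Q` containing `x`, of the average of `|f|` over `Q`. -/
def mx {n : ℕ} (f : (Fin n → ℝ) → ℝ) (x : Fin n → ℝ) : ℝ≥0∞ :=
  ⨆ (a : Fin n → ℝ) (s : ℝ) (_ : 0 < s) (_ : x ∈ cube a s),
    (volume (cube a s))⁻¹ * ∫⁻ y in cube a s, (‖f y‖₊ : ℝ≥0∞)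

/-- Maximal function of a function defined on `Ω`, computed after extending by zero. -/
def mxOn {n : ℕ} (Ω : Set (Fin n → ℝ)) (f : (Fin n → ℝ) → ℝ) (x : Fin n → ℝ) : ℝ≥0∞ :=
  mx (Ω.indicator f) x

/-- `p₊(E)`: the essential supremum of the exponent over `E`. -/
def pSup {n : ℕ} (E : Set (Fin n → ℝ)) (p : (Fin n → ℝ) → ℝ) : ℝ≥0∞ :=
  essSup (fun x => ENNReal.ofReal (p x)) (volume.restrict E)

/-- `p₋(E)`: the essential infimum of the exponent over `E`. -/
def pInf {n : ℕ} (E : Set (Fin n → ℝ)) (p : (Fin n → ℝ) → ℝ) : ℝ≥0∞ :=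
  essInf (fun x => ENNReal.ofReal (p x)) (volume.restrict E)

/-- `p ∈ 𝒫(Ω)`: a measurable exponent function with values in `[1, ∞)` on `Ω`. -/
def IsExponent {n : ℕ} (Ω : Set (Fin n → ℝ)) (p : (Fin n → ℝ) → ℝ) : Prop :=
  Measurable p ∧ ∀ x ∈ Ω, 1 ≤ p x

/-- The modular inequality `∫_Ω (Mf(x))^{p(x)} dx ≤ c₁ ∫_Ω |f(x)|^{q(x)} dx + c₂`
for every measurable function `f` on `Ω`. -/
def ModIneq {n : ℕ} (Ω : Set (Fin n → ℝ)) (p q : (Fin n → ℝ) → ℝ) (c₁ c₂ : ℝ) : Prop :=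
  ∀ f : (Fin n → ℝ) → ℝ, Measurable f →
    ∫⁻ x in Ω, (mxOn Ω f x) ^ (p x) ≤
      ENNReal.ofReal c₁ * ∫⁻ x in Ω, (‖f x‖₊ : ℝ≥0∞) ^ (q x) + ENNReal.ofReal c₂

/-- `p` and `q` touch at infinity on `Ω`: for every measurable `E ⊆ Ω` of infinite
measure, `p₊(E) = p₊(Ω) = q₋(Ω) = q₋(E)`. -/
def TouchAtInfinity {n : ℕ} (Ω : Set (Fin n → ℝ)) (p q : (Fin n → ℝ) → ℝ) : Prop :=
  ∀ E : Set (Fin n → ℝ), MeasurableSet E → E ⊆ Ω → volume E = ⊤ →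
    pSup E p = pSup Ω p ∧ pSup Ω p = pInf Ω q ∧ pInf Ω q = pInf E q

theorem cube_eq_ball {n : ℕ} (a : Fin n → ℝ) {s : ℝ} (hs : 0 < s) :
    cube a s = Metric.ball (fun i => a i + s / 2) (s / 2) := by
  rw [cube, ball_pi _ (half_pos hs)]
  congr 1
  ext i x
  rw [Real.ball_eq_Ioo]
  ring_nf

theorem volume_cube {n : ℕ} (a : Fin n → ℝ) (s : ℝ) :
    volume (cube a s) = ENNReal.ofReal s ^ n := by
  simp [cube, Real.volume_pi_Ioo]

theorem isOpen_cube {n : ℕ} (a : Fin n → ℝ) (s : ℝ) : IsOpen (cube a s) :=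
  isOpen_set_pi finite_univ fun _ _ => isOpen_Ioo

theorem volume_cube_ne_zero {n : ℕ} (a : Fin n → ℝ) {s : ℝ} (hs : 0 < s) :
    volume (cube a s) ≠ 0 := by
  rw [volume_cube]
  exact pow_ne_zero _ (ENNReal.ofReal_pos.2 hs).ne'

theorem volume_cube_ne_top {n : ℕ} (a : Fin n → ℝ) (s : ℝ) : volume (cube a s) ≠ ⊤ := by
  rw [volume_cube]
  exact ENNReal.pow_ne_top ENNReal.ofReal_ne_top

theorem average_le_mx {n : ℕ} (f : (Fin n → ℝ) → ℝ) {a x : Fin n → ℝ} {s : ℝ} (hs : 0 < s)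
    (hx : x ∈ cube a s) :
    (volume (cube a s))⁻¹ * ∫⁻ y in cube a s, (‖f y‖₊ : ℝ≥0∞) ≤ mx f x :=
  le_iSup_of_le a <| le_iSup_of_le s <| le_iSup_of_le hs <| le_iSup_of_le hx le_rfl

theorem lt_mx_iff {n : ℕ} {f : (Fin n → ℝ) → ℝ} {x : Fin n → ℝ} {t : ℝ≥0∞} :
    t < mx f x ↔ ∃ (a : Fin n → ℝ) (s : ℝ), 0 < s ∧ x ∈ cube a s ∧
      t < (volume (cube a s))⁻¹ * ∫⁻ y in cube a s, (‖f y‖₊ : ℝ≥0∞) := by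
  simp only [mx, lt_iSup_iff, exists_prop]

theorem isOpen_setOf_lt_mx {n : ℕ} (f : (Fin n → ℝ) → ℝ) (t : ℝ≥0∞) :
    IsOpen {x | t < mx f x} := by
  rw [isOpen_iff_mem_nhds]
  intro x hx
  obtain ⟨a, s, hs, hxs, ht⟩ := lt_mx_iff.1 hx
  filter_upwards [(isOpen_cube a s).mem_nhds hxs] with y hy
  exact lt_mx_iff.2 ⟨a, s, hs, hy, ht⟩

/-- The weak type `(1, 1)` estimate for the maximal function. -/
theorem mul_volume_lt_mx_le {n : ℕ} (hn : 0 < n) (f : (Fin n → ℝ) → ℝ) {t : ℝ≥0∞} (ht : t ≠ 0) :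
    t * volume {x | t < mx f x} ≤ 4 ^ n * ∫⁻ y, (‖f y‖₊ : ℝ≥0∞) := by
  by_cases hf : ∫⁻ y, (‖f y‖₊ : ℝ≥0∞) = ⊤
  · rw [hf, ENNReal.mul_top (by positivity)]
    exact le_top
  rcases eq_or_ne t ⊤ with rfl | ht'
  · simp
  let T : Set ((Fin n → ℝ) × ℝ) := {c | 0 < c.2 ∧
    t < (volume (cube c.1 c.2))⁻¹ * ∫⁻ y in cube c.1 c.2, (‖f y‖₊ : ℝ≥0∞)}
  have hvol : ∀ c ∈ T, t * volume (cube c.1 c.2) ≤ ∫⁻ y in cube c.1 c.2, (‖f y‖₊ : ℝ≥0∞) := by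
    intro c hc
    rw [← ENNReal.le_div_iff_mul_le (Or.inl (volume_cube_ne_zero _ hc.1))
      (Or.inl (volume_cube_ne_top _ _)), ENNReal.div_eq_inv_mul]
    exact hc.2.le
  set K : ℝ≥0∞ := (∫⁻ y, (‖f y‖₊ : ℝ≥0∞)) / t with hK
  have hKtop : K ≠ ⊤ := ENNReal.div_ne_top hf ht
  have hrad : ∀ c ∈ T, c.2 / 2 ≤ max 1 K.toReal := by
    intro c hc
    have h1 : volume (cube c.1 c.2) ≤ K := by
      rw [hK, ENNReal.le_div_iff_mul_le (Or.inl ht) (Or.inl ht'), mul_comm]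
      exact (hvol c hc).trans (setLIntegral_le_lintegral _ _)
    rw [volume_cube, ← ENNReal.ofReal_pow hc.1.le, ENNReal.ofReal_le_iff_le_toReal hKtop] at h1
    rcases le_total c.2 1 with h | h
    · exact le_max_of_le_left (by linarith [hc.1])
    · have := le_self_pow₀ h hn.ne'
      exact le_max_of_le_right (by linarith [hc.1])
  obtain ⟨u, huT, hdisj, hcov⟩ := Vitali.exists_disjoint_subfamily_covering_enlargement_ball T
    (fun c i => c.1 i + c.2 / 2) (fun c => c.2 / 2) _ hrad 4 (by norm_num)
  have hball : ∀ c ∈ u, Metric.ball (fun i => c.1 i + c.2 / 2) (c.2 / 2) = cube c.1 c.2 :=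
    fun c hc => (cube_eq_ball c.1 (huT hc).1).symm
  have hdisj' : u.PairwiseDisjoint fun c => cube c.1 c.2 := by
    intro c hc d hd hcd
    have := hdisj hc hd hcd
    simpa only [Function.onFun, hball c hc, hball d hd] using this
  have hcount : u.Countable := by
    refine hdisj'.countable_of_isOpen (fun c _ => isOpen_cube _ _) fun c hc => ?_
    exact nonempty_of_measure_ne_zero (volume_cube_ne_zero c.1 (huT hc).1)
  have hsub : {x | t < mx f x} ⊆
      ⋃ c ∈ u, Metric.ball (fun i => c.1 i + c.2 / 2) (4 * (c.2 / 2)) := by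
    intro x hx
    obtain ⟨a, s, hs, hxs, hts⟩ := lt_mx_iff.1 hx
    obtain ⟨d, hd, hsubd⟩ := hcov (a, s) ⟨hs, hts⟩
    rw [cube_eq_ball a hs] at hxs
    exact mem_biUnion hd (hsubd hxs)
  have hbig : ∀ c ∈ u, volume (Metric.ball (fun i => c.1 i + c.2 / 2) (4 * (c.2 / 2))) =
      4 ^ n * volume (cube c.1 c.2) := by
    intro c hc
    have hc0 := (huT hc).1
    rw [Real.volume_pi_ball _ (by positivity), volume_cube, Fintype.card_fin,
      show 2 * (4 * (c.2 / 2)) = 4 * c.2 by ring, mul_pow, ENNReal.ofReal_mul (by positivity),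
      ENNReal.ofReal_pow hc0.le, ENNReal.ofReal_pow (by norm_num)]
    norm_num
  calc t * volume {x | t < mx f x}
      ≤ t * ∑' c : u, volume (Metric.ball (fun i => c.1.1 i + c.1.2 / 2) (4 * (c.1.2 / 2))) := by
        gcongr
        exact (measure_mono hsub).trans (measure_biUnion_le _ hcount _)
    _ = 4 ^ n * ∑' c : u, t * volume (cube c.1.1 c.1.2) := by
        rw [← ENNReal.tsum_mul_left, ← ENNReal.tsum_mul_left]
        refine tsum_congr fun c => ?_
        rw [hbig c.1 c.2]
        ring
    _ ≤ 4 ^ n * ∑' c : u, ∫⁻ y in cube c.1.1 c.1.2, (‖f y‖₊ : ℝ≥0∞) := by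
        gcongr with c
        exact hvol c.1 (huT c.2)
    _ = 4 ^ n * ∫⁻ y in ⋃ c ∈ u, cube c.1 c.2, (‖f y‖₊ : ℝ≥0∞) := by
        rw [lintegral_biUnion hcount (fun c _ => (isOpen_cube _ _).measurableSet) hdisj']
    _ ≤ 4 ^ n * ∫⁻ y, (‖f y‖₊ : ℝ≥0∞) := by
        gcongr
        exact Measure.restrict_le_self

theorem mx_le_mx_indicator_add {n : ℕ} {f : (Fin n → ℝ) → ℝ} (t : ℝ≥0∞)
    (x : Fin n → ℝ) : mx f x ≤ mx ({y | t < (‖f y‖₊ : ℝ≥0∞)}.indicator f) x + t := by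
  refine iSup_le fun a => iSup_le fun s => iSup_le fun hs => iSup_le fun hx => ?_
  have h0 := volume_cube_ne_zero a hs
  have h1 := volume_cube_ne_top a s
  set g := {y | t < (‖f y‖₊ : ℝ≥0∞)}.indicator f with hg
  calc (volume (cube a s))⁻¹ * ∫⁻ y in cube a s, (‖f y‖₊ : ℝ≥0∞)
      ≤ (volume (cube a s))⁻¹ * ∫⁻ y in cube a s, ((‖g y‖₊ : ℝ≥0∞) + t) := by
        gcongr with y
        by_cases hy : t < (‖f y‖₊ : ℝ≥0∞)
        · rw [hg, indicator_of_mem (by exact hy)]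
          exact le_self_add
        · exact (not_lt.1 hy).trans le_add_self
    _ = (volume (cube a s))⁻¹ * (∫⁻ y in cube a s, (‖g y‖₊ : ℝ≥0∞)) + t := by
        rw [lintegral_add_right _ measurable_const, mul_add, setLIntegral_const, mul_comm t,
          ← mul_assoc, ENNReal.inv_mul_cancel h0 h1, one_mul]
    _ ≤ mx g x + t := by
        gcongr
        exact average_le_mx g hs hx

theorem mul_volume_two_mul_lt_mx_le {n : ℕ} (hn : 0 < n) {f : (Fin n → ℝ) → ℝ}
    (hf : Measurable f) {t : ℝ≥0∞} (ht : t ≠ 0) (ht' : t ≠ ⊤) :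
    t * volume {x | 2 * t < mx f x} ≤
      4 ^ n * ∫⁻ y in {y | t < (‖f y‖₊ : ℝ≥0∞)}, (‖f y‖₊ : ℝ≥0∞) := by
  have hset : MeasurableSet {y | t < (‖f y‖₊ : ℝ≥0∞)} :=
    measurableSet_lt measurable_const hf.nnnorm.coe_nnreal_ennreal
  calc t * volume {x | 2 * t < mx f x}
      ≤ t * volume {x | t < mx ({y | t < (‖f y‖₊ : ℝ≥0∞)}.indicator f) x} := by
        refine mul_le_mul' le_rfl (measure_mono fun x (hx : 2 * t < mx f x) => ?_)
        have := hx.trans_le (mx_le_mx_indicator_add t x)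
        rw [two_mul] at this
        exact (ENNReal.add_lt_add_iff_right ht').1 this
    _ ≤ _ := mul_volume_lt_mx_le hn _ ht
    _ = _ := by
        rw [← lintegral_indicator hset]
        congr 2
        ext y
        by_cases hy : y ∈ {y | t < (‖f y‖₊ : ℝ≥0∞)} <;> simp [hy, indicator]

theorem rpow_le_add_tsum_dyadic {r : ℝ} (hr : 0 ≤ r) (y : ℝ≥0∞) :
    y ^ r ≤ 2 ^ r + ∑' k : ℕ, {z : ℝ≥0∞ | 2 * 2 ^ k < z}.indicator
      (fun _ => ((2 : ℝ≥0∞) ^ (k + 2)) ^ r) y := by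
  rcases le_or_gt y 2 with hy | hy
  · exact (ENNReal.rpow_le_rpow hy hr).trans le_self_add
  refine le_trans ?_ le_add_self
  rcases eq_or_ne y ⊤ with rfl | hy'
  · have : (⊤ : ℝ≥0∞) ≤ ∑' k : ℕ, {z : ℝ≥0∞ | 2 * 2 ^ k < z}.indicator
        (fun _ => ((2 : ℝ≥0∞) ^ (k + 2)) ^ r) ⊤ := by
      refine (ENNReal.tsum_const_eq_top_of_ne_zero (α := ℕ) one_ne_zero).ge.trans
        (ENNReal.tsum_le_tsum fun k => ?_)
      rw [indicator_of_mem (by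
        exact ENNReal.mul_lt_top ENNReal.ofNat_lt_top (ENNReal.pow_lt_top ENNReal.ofNat_lt_top))]
      simpa using ENNReal.rpow_le_rpow (one_le_pow₀ (one_le_two (α := ℝ≥0∞)) (n := k + 2)) hr
    exact le_top.trans this
  have hex : ∃ k : ℕ, y ≤ 2 ^ (k + 2) := by
    lift y to NNReal using hy'
    obtain ⟨k, hk⟩ := pow_unbounded_of_one_lt y (one_lt_two (α := NNReal))
    refine ⟨k, ?_⟩
    have h := hk.le.trans (pow_le_pow_right₀ one_le_two (by omega : k ≤ k + 2))
    exact_mod_cast h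
  classical
  have hlow : 2 * 2 ^ Nat.find hex < y := by
    rcases h : Nat.find hex with _ | m
    · simpa using hy
    · have := Nat.find_min hex (m := m) (by omega)
      rw [not_le] at this
      convert this using 1
      ring
  calc y ^ r ≤ (2 ^ (Nat.find hex + 2)) ^ r := ENNReal.rpow_le_rpow (Nat.find_spec hex) hr
    _ = {z : ℝ≥0∞ | 2 * 2 ^ Nat.find hex < z}.indicator
          (fun _ => ((2 : ℝ≥0∞) ^ (Nat.find hex + 2)) ^ r) y := by
        rw [indicator_of_mem (by exact hlow)]
    _ ≤ _ := ENNReal.le_tsum (f := fun k : ℕ => {z : ℝ≥0∞ | 2 * 2 ^ k < z}.indicator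
          (fun _ => ((2 : ℝ≥0∞) ^ (k + 2)) ^ r) y) _

theorem dyadic_weight_eq (r : ℝ) (k : ℕ) :
    ((2 : ℝ≥0∞) ^ (k + 2)) ^ r * ((2 : ℝ≥0∞) ^ k)⁻¹ =
      ENNReal.ofReal (4 ^ r * (2 ^ (r - 1)) ^ k) := by
  have h2 : (2 : ℝ≥0∞) = ENNReal.ofReal 2 := by norm_num
  rw [h2, ← ENNReal.ofReal_pow (by norm_num), ← ENNReal.ofReal_pow (by norm_num),
    ENNReal.ofReal_rpow_of_pos (by positivity), ← ENNReal.ofReal_inv_of_pos (by positivity),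
    ← ENNReal.ofReal_mul (by positivity)]
  congr 1
  rw [pow_add, Real.mul_rpow (by positivity) (by positivity),
    ← Real.rpow_mul_natCast (by norm_num), sub_mul, one_mul, Real.rpow_sub (by norm_num),
    Real.rpow_natCast, ← Real.rpow_natCast_mul (by norm_num), mul_comm r]
  norm_num
  ring

theorem exists_tsum_dyadic_weight_le {r : ℝ} (hr : 1 < r) :
    ∃ C : ℝ≥0∞, C ≠ ⊤ ∧ ∀ v : NNReal, ∑' k : ℕ, {z : ℝ≥0∞ | 2 ^ k < z}.indicator
      (fun z => ((2 : ℝ≥0∞) ^ (k + 2)) ^ r * ((2 : ℝ≥0∞) ^ k)⁻¹ * z) (v : ℝ≥0∞) ≤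
        C * (v : ℝ≥0∞) ^ r := by
  set b : ℝ := 2 ^ (r - 1) with hb
  have hb1 : 1 < b := Real.one_lt_rpow one_lt_two (by linarith)
  refine ⟨ENNReal.ofReal (4 ^ r * (b / (b - 1))), ENNReal.ofReal_ne_top, fun v => ?_⟩
  rcases le_or_gt v 1 with hv | hv
  · have : ∀ k : ℕ, {z : ℝ≥0∞ | 2 ^ k < z}.indicator
      (fun z => ((2 : ℝ≥0∞) ^ (k + 2)) ^ r * ((2 : ℝ≥0∞) ^ k)⁻¹ * z) (v : ℝ≥0∞) = 0 := by
      intro k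
      refine indicator_of_notMem ?_ _
      simp only [mem_ofPred_eq, not_lt]
      exact (ENNReal.coe_le_one_iff.2 hv).trans (one_le_pow₀ one_le_two)
    simp [this]
  obtain ⟨m, hm, hm'⟩ := exists_nat_pow_near hv.le (one_lt_two (α := NNReal))
  have hv0 : (0 : ℝ) < v := zero_lt_one.trans (by exact_mod_cast hv)
  have hm2 : ((2 : ℝ) ^ m) ≤ v := by exact_mod_cast hm
  have hbm : b ^ m ≤ (v : ℝ) ^ (r - 1) := by
    rw [hb, ← Real.rpow_mul_natCast (by norm_num), mul_comm, Real.rpow_natCast_mul (by norm_num)]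
    exact Real.rpow_le_rpow (by positivity) hm2 (by linarith)
  have hsum : ∑ k ∈ Finset.range (m + 1), 4 ^ r * b ^ k * v ≤
      4 ^ r * (b / (b - 1)) * (v : ℝ) ^ r := by
    rw [← Finset.sum_mul, ← Finset.mul_sum, geom_sum_eq hb1.ne',
      show (v : ℝ) ^ r = v ^ (r - 1) * v by rw [← Real.rpow_add_one hv0.ne']; ring_nf,
      ← mul_assoc, mul_assoc (4 ^ r : ℝ) (b / (b - 1))]
    have hb0 : 0 < b - 1 := by linarith
    gcongr
    rw [div_mul_eq_mul_div]
    gcongr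
    rw [pow_succ]
    nlinarith
  calc ∑' k : ℕ, {z : ℝ≥0∞ | 2 ^ k < z}.indicator
        (fun z => ((2 : ℝ≥0∞) ^ (k + 2)) ^ r * ((2 : ℝ≥0∞) ^ k)⁻¹ * z) (v : ℝ≥0∞)
      = ∑ k ∈ Finset.range (m + 1), {z : ℝ≥0∞ | 2 ^ k < z}.indicator
        (fun z => ((2 : ℝ≥0∞) ^ (k + 2)) ^ r * ((2 : ℝ≥0∞) ^ k)⁻¹ * z) (v : ℝ≥0∞) := by
        refine tsum_eq_sum fun k hk => indicator_of_notMem ?_ _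
        simp only [Finset.mem_range, not_lt] at hk
        simp only [mem_ofPred_eq, not_lt]
        have h := hm'.le.trans (pow_le_pow_right₀ one_le_two hk)
        exact_mod_cast h
    _ ≤ ∑ k ∈ Finset.range (m + 1), ENNReal.ofReal (4 ^ r * b ^ k * v) := by
        refine Finset.sum_le_sum fun k _ => (indicator_le_self' (fun _ _ => zero_le) _).trans ?_
        rw [dyadic_weight_eq, ENNReal.ofReal_mul (q := (v : ℝ)) (by positivity),
          ENNReal.ofReal_coe_nnreal]
    _ = ENNReal.ofReal (∑ k ∈ Finset.range (m + 1), 4 ^ r * b ^ k * v) :=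
        (ENNReal.ofReal_sum_of_nonneg fun k _ => by positivity).symm
    _ ≤ ENNReal.ofReal (4 ^ r * (b / (b - 1)) * (v : ℝ) ^ r) := ENNReal.ofReal_le_ofReal hsum
    _ = _ := by
        have hb0 : 0 < b - 1 := by linarith
        rw [ENNReal.ofReal_mul (by positivity), ← ENNReal.ofReal_rpow_of_pos hv0,
          ENNReal.ofReal_coe_nnreal]

/-- The strong type `(r, r)` estimate for the maximal function over a set, with an additive
error proportional to the measure of the set. -/
theorem exists_setLIntegral_mx_rpow_le {n : ℕ} (hn : 0 < n) {r : ℝ} (hr : 1 < r) :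
    ∃ C : ℝ≥0∞, C ≠ ⊤ ∧ ∀ (Ω : Set (Fin n → ℝ)) (f : (Fin n → ℝ) → ℝ), Measurable f →
      ∫⁻ x in Ω, mx f x ^ r ≤ 2 ^ r * volume Ω + C * ∫⁻ y, (‖f y‖₊ : ℝ≥0∞) ^ r := by
  obtain ⟨C, hC, hle⟩ := exists_tsum_dyadic_weight_le hr
  refine ⟨4 ^ n * C, ENNReal.mul_ne_top (ENNReal.pow_ne_top (by simp)) hC, fun Ω f hf => ?_⟩
  have hnorm : Measurable fun y => (‖f y‖₊ : ℝ≥0∞) := hf.nnnorm.coe_nnreal_ennreal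
  have hopen : ∀ k : ℕ, MeasurableSet {x | 2 * 2 ^ k < mx f x} :=
    fun k => (isOpen_setOf_lt_mx f _).measurableSet
  have hlevel : ∀ k : ℕ, ((2 : ℝ≥0∞) ^ (k + 2)) ^ r * volume.restrict Ω {x | 2 * 2 ^ k < mx f x} ≤
      4 ^ n * ∫⁻ y, {z : ℝ≥0∞ | 2 ^ k < z}.indicator
        (fun z => ((2 : ℝ≥0∞) ^ (k + 2)) ^ r * ((2 : ℝ≥0∞) ^ k)⁻¹ * z) (‖f y‖₊ : ℝ≥0∞) := by
    intro k
    have h0 : (2 : ℝ≥0∞) ^ k ≠ 0 := by positivity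
    have h1 : (2 : ℝ≥0∞) ^ k ≠ ⊤ := ENNReal.pow_ne_top (by simp)
    have hset : MeasurableSet {y | 2 ^ k < (‖f y‖₊ : ℝ≥0∞)} :=
      measurableSet_lt measurable_const hnorm
    have hint : ∫⁻ y, {z : ℝ≥0∞ | 2 ^ k < z}.indicator
        (fun z => ((2 : ℝ≥0∞) ^ (k + 2)) ^ r * ((2 : ℝ≥0∞) ^ k)⁻¹ * z) (‖f y‖₊ : ℝ≥0∞) =
        ((2 : ℝ≥0∞) ^ (k + 2)) ^ r * ((2 : ℝ≥0∞) ^ k)⁻¹ *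
          ∫⁻ y in {y | 2 ^ k < (‖f y‖₊ : ℝ≥0∞)}, (‖f y‖₊ : ℝ≥0∞) := by
      rw [← lintegral_const_mul _ hnorm, ← lintegral_indicator hset]
      rfl
    rw [hint]
    calc ((2 : ℝ≥0∞) ^ (k + 2)) ^ r * volume.restrict Ω {x | 2 * 2 ^ k < mx f x}
        ≤ ((2 : ℝ≥0∞) ^ (k + 2)) ^ r * volume {x | 2 * 2 ^ k < mx f x} := by
          gcongr
          exact Measure.restrict_le_self
      _ = ((2 : ℝ≥0∞) ^ (k + 2)) ^ r * ((2 : ℝ≥0∞) ^ k)⁻¹ *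
            (2 ^ k * volume {x | 2 * 2 ^ k < mx f x}) := by
          rw [mul_assoc, ← mul_assoc _ (2 ^ k), ENNReal.inv_mul_cancel h0 h1, one_mul]
      _ ≤ ((2 : ℝ≥0∞) ^ (k + 2)) ^ r * ((2 : ℝ≥0∞) ^ k)⁻¹ *
            (4 ^ n * ∫⁻ y in {y | 2 ^ k < (‖f y‖₊ : ℝ≥0∞)}, (‖f y‖₊ : ℝ≥0∞)) :=
          mul_le_mul' le_rfl (mul_volume_two_mul_lt_mx_le hn hf h0 h1)
      _ = _ := by ring
  calc ∫⁻ x in Ω, mx f x ^ r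
      ≤ ∫⁻ x in Ω, (2 ^ r + ∑' k : ℕ, {x | 2 * 2 ^ k < mx f x}.indicator
          (fun _ => ((2 : ℝ≥0∞) ^ (k + 2)) ^ r) x) :=
        lintegral_mono fun x => rpow_le_add_tsum_dyadic (by linarith) (mx f x)
    _ = 2 ^ r * volume Ω + ∑' k : ℕ,
          ((2 : ℝ≥0∞) ^ (k + 2)) ^ r * volume.restrict Ω {x | 2 * 2 ^ k < mx f x} := by
        rw [lintegral_add_left measurable_const, setLIntegral_const,
          lintegral_tsum fun k => (measurable_const.indicator (hopen k)).aemeasurable]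
        simp_rw [lintegral_indicator_const (hopen _)]
    _ ≤ 2 ^ r * volume Ω + ∑' k : ℕ, 4 ^ n * ∫⁻ y, {z : ℝ≥0∞ | 2 ^ k < z}.indicator
        (fun z => ((2 : ℝ≥0∞) ^ (k + 2)) ^ r * ((2 : ℝ≥0∞) ^ k)⁻¹ * z) (‖f y‖₊ : ℝ≥0∞) :=
        add_le_add le_rfl (ENNReal.tsum_le_tsum hlevel)
    _ = 2 ^ r * volume Ω + 4 ^ n * ∫⁻ y, ∑' k : ℕ, {z : ℝ≥0∞ | 2 ^ k < z}.indicator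
        (fun z => ((2 : ℝ≥0∞) ^ (k + 2)) ^ r * ((2 : ℝ≥0∞) ^ k)⁻¹ * z) (‖f y‖₊ : ℝ≥0∞) := by
        rw [ENNReal.tsum_mul_left, lintegral_tsum fun k => ?_]
        exact (((measurable_id.const_mul _).indicator measurableSet_Ioi).comp hnorm).aemeasurable
    _ ≤ 2 ^ r * volume Ω + 4 ^ n * ∫⁻ y, C * (‖f y‖₊ : ℝ≥0∞) ^ r := by
        gcongr with y
        exact hle _
    _ = _ := by rw [lintegral_const_mul _ (hnorm.pow_const r), mul_assoc]

theorem rpow_le_one_add_rpow (y : ℝ≥0∞) {p r : ℝ} (hp : 0 ≤ p) (hpr : p ≤ r) :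
    y ^ p ≤ 1 + y ^ r := by
  rcases le_total y 1 with hy | hy
  · exact (ENNReal.rpow_le_one hy hp).trans le_self_add
  · exact (ENNReal.rpow_le_rpow_of_exponent_le hy hpr).trans le_add_self

theorem pInf_ne_top {n : ℕ} {Ω : Set (Fin n → ℝ)} (hΩ : volume Ω ≠ 0) (q : (Fin n → ℝ) → ℝ) :
    pInf Ω q ≠ ⊤ := by
  have : NeZero (volume.restrict Ω) := ⟨by simpa using hΩ⟩
  obtain ⟨x, hx⟩ := (ae_essInf_le (μ := volume.restrict Ω)
    (f := fun x => ENNReal.ofReal (q x))).exists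
  exact (hx.trans_lt ENNReal.ofReal_lt_top).ne

theorem mul_setLIntegral_add_ofReal {n : ℕ} {Ω : Set (Fin n → ℝ)} (hΩfin : volume Ω < ⊤)
    (g : (Fin n → ℝ) → ℝ≥0∞) {c₁ c₂ : ℝ} (hc₁ : 0 ≤ c₁) (hc₂ : 0 ≤ c₂) :
    ENNReal.ofReal c₁ * ∫⁻ x in Ω, (g x + ENNReal.ofReal c₂) =
      ENNReal.ofReal c₁ * (∫⁻ x in Ω, g x) + ENNReal.ofReal (c₁ * c₂ * (volume Ω).toReal) := by
  rw [lintegral_add_right _ measurable_const, setLIntegral_const, mul_add,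
    ENNReal.ofReal_mul (by positivity), ENNReal.ofReal_mul hc₁, ENNReal.ofReal_toReal hΩfin.ne,
    mul_assoc]

theorem exists_modIneq_of_pSup_le_pInf {n : ℕ} (hn : 0 < n) {Ω : Set (Fin n → ℝ)}
    (hΩmeas : MeasurableSet Ω) (hΩpos : 0 < volume Ω) (hΩfin : volume Ω < ⊤)
    {p q : (Fin n → ℝ) → ℝ} (hp : IsExponent Ω p) (hq : IsExponent Ω q) (hp1 : 1 < pSup Ω p)
    (hpq : pSup Ω p ≤ pInf Ω q) : ∃ c₁ c₂ : ℝ, 0 < c₁ ∧ 0 ≤ c₂ ∧ ModIneq Ω p q c₁ c₂ := by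
  have htop : pSup Ω p ≠ ⊤ := (hpq.trans_lt (pInf_ne_top hΩpos.ne' q).lt_top).ne
  set r := (pSup Ω p).toReal with hrdef
  have hr : 1 < r := by
    rw [hrdef, ← ENNReal.toReal_one]
    exact (ENNReal.toReal_lt_toReal ENNReal.one_ne_top htop).2 hp1
  obtain ⟨C, hC, hstrong⟩ := exists_setLIntegral_mx_rpow_le hn hr
  have hpr : ∀ᵐ x ∂volume.restrict Ω, 0 ≤ p x ∧ p x ≤ r := by
    filter_upwards [ENNReal.ae_le_essSup (μ := volume.restrict Ω) fun x => ENNReal.ofReal (p x),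
      ae_restrict_mem hΩmeas] with x hx hxΩ
    exact ⟨zero_le_one.trans (hp.2 x hxΩ), (ENNReal.ofReal_le_iff_le_toReal htop).1 hx⟩
  have hrq : ∀ᵐ x ∂volume.restrict Ω, r ≤ q x := by
    filter_upwards [ae_essInf_le (μ := volume.restrict Ω) (f := fun x => ENNReal.ofReal (q x)),
      ae_restrict_mem hΩmeas] with x hx hxΩ
    exact ENNReal.toReal_le_of_le_ofReal (zero_le_one.trans (hq.2 x hxΩ)) (hpq.trans hx)
  set D : ℝ≥0∞ := volume Ω + 2 ^ r * volume Ω + C * volume Ω with hD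
  have hDtop : D ≠ ⊤ := by
    have h2 : (2 : ℝ≥0∞) ^ r ≠ ⊤ := ENNReal.rpow_ne_top_of_nonneg (by linarith) (by simp)
    exact ENNReal.add_ne_top.2 ⟨ENNReal.add_ne_top.2 ⟨hΩfin.ne, ENNReal.mul_ne_top h2 hΩfin.ne⟩,
      ENNReal.mul_ne_top hC hΩfin.ne⟩
  have hΩreal : 0 < (volume Ω).toReal := ENNReal.toReal_pos hΩpos.ne' hΩfin.ne
  refine ⟨C.toReal + 1, D.toReal / (volume Ω).toReal, by positivity, by positivity,
    fun f hf => ?_⟩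
  rw [mul_setLIntegral_add_ofReal hΩfin _ (by positivity) (by positivity)]
  have hnorm : Measurable fun y => (‖f y‖₊ : ℝ≥0∞) := hf.nnnorm.coe_nnreal_ennreal
  have hext : ∫⁻ y, (‖Ω.indicator f y‖₊ : ℝ≥0∞) ^ r = ∫⁻ y in Ω, (‖f y‖₊ : ℝ≥0∞) ^ r := by
    rw [← lintegral_indicator hΩmeas]
    congr 1
    ext y
    by_cases hy : y ∈ Ω
    · simp [hy]
    · simp [hy, (zero_lt_one.trans hr)]
  have hC' : C ≤ ENNReal.ofReal (C.toReal + 1) := by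
    rw [ENNReal.le_ofReal_iff_toReal_le hC (by positivity)]
    linarith
  calc ∫⁻ x in Ω, mxOn Ω f x ^ p x
      ≤ ∫⁻ x in Ω, (1 + mxOn Ω f x ^ r) := by
        refine lintegral_mono_ae ?_
        filter_upwards [hpr] with x hx
        exact rpow_le_one_add_rpow _ hx.1 hx.2
    _ = volume Ω + ∫⁻ x in Ω, mx (Ω.indicator f) x ^ r := by
        rw [lintegral_add_left measurable_const, setLIntegral_one]
        rfl
    _ ≤ volume Ω + (2 ^ r * volume Ω + C * ∫⁻ y in Ω, (‖f y‖₊ : ℝ≥0∞) ^ r) := by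
        rw [← hext]
        exact add_le_add le_rfl (hstrong Ω _ (hf.indicator hΩmeas))
    _ ≤ volume Ω + (2 ^ r * volume Ω + C * ∫⁻ y in Ω, (1 + (‖f y‖₊ : ℝ≥0∞) ^ q y)) := by
        gcongr _ + (_ + _ * ?_)
        refine lintegral_mono_ae ?_
        filter_upwards [hrq] with x hx
        exact rpow_le_one_add_rpow _ (by linarith) hx
    _ = C * (∫⁻ y in Ω, (‖f y‖₊ : ℝ≥0∞) ^ q y) + D := by
        rw [lintegral_add_left measurable_const, setLIntegral_one, hD]
        ring
    _ ≤ _ := by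
        gcongr
        rw [ENNReal.le_ofReal_iff_toReal_le hDtop (by positivity), mul_assoc,
          div_mul_cancel₀ _ hΩreal.ne']
        exact le_mul_of_one_le_left ENNReal.toReal_nonneg (by simp)

theorem exists_nat_volume_inter_cube_ne_zero {n : ℕ} {A : Set (Fin n → ℝ)} (hA : volume A ≠ 0) :
    ∃ N : ℕ, ∀ M : ℕ, N ≤ M → volume (A ∩ cube (fun _ => -(M : ℝ)) (2 * M)) ≠ 0 := by
  have hcov : A ⊆ ⋃ N : ℕ, A ∩ cube (fun _ => -(N : ℝ)) (2 * N) := by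
    intro x hx
    obtain ⟨N, hN⟩ := exists_nat_gt ‖x‖
    refine mem_iUnion.2 ⟨N, hx, fun i _ => ?_⟩
    have := abs_lt.1 ((norm_le_pi_norm x i).trans_lt hN)
    exact ⟨this.1, by linarith [this.2]⟩
  obtain ⟨N, hN⟩ := exists_measure_pos_of_not_measure_iUnion_null
    (fun h => hA (measure_mono_null hcov h))
  refine ⟨N, fun M hM h => hN.ne' (measure_mono_null ?_ h)⟩
  have hM' : (N : ℝ) ≤ M := by exact_mod_cast hM
  refine inter_subset_inter_right _ fun x hx i hi => ?_
  have := hx i hi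
  exact ⟨by linarith [this.1], by linarith [this.2]⟩

theorem volume_setOf_lt_ne_zero_of_lt_pSup {n : ℕ} {Ω : Set (Fin n → ℝ)}
    (hΩmeas : MeasurableSet Ω) {p : (Fin n → ℝ) → ℝ} {a : ℝ}
    (ha : ENNReal.ofReal a < pSup Ω p) : volume (Ω ∩ {x | a < p x}) ≠ 0 := by
  intro h
  refine ha.not_ge (essSup_le_of_ae_le _ ?_)
  rw [Filter.EventuallyLE, ae_restrict_iff' hΩmeas, ae_iff]
  refine measure_mono_null (fun x hx => ?_) h
  simp only [mem_ofPred_eq, Classical.not_imp, not_le] at hx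
  exact ⟨hx.1, lt_of_not_ge fun hle => hx.2.not_ge (ENNReal.ofReal_le_ofReal hle)⟩

theorem volume_setOf_lt_ne_zero_of_pInf_lt {n : ℕ} {Ω : Set (Fin n → ℝ)}
    (hΩmeas : MeasurableSet Ω) {q : (Fin n → ℝ) → ℝ} {b : ℝ}
    (hb : pInf Ω q < ENNReal.ofReal b) : volume (Ω ∩ {x | q x < b}) ≠ 0 := by
  intro h
  refine hb.not_ge (le_essInf_of_ae_le _ ?_)
  rw [Filter.EventuallyLE, ae_restrict_iff' hΩmeas, ae_iff]
  refine measure_mono_null (fun x hx => ?_) h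
  simp only [mem_ofPred_eq, Classical.not_imp, not_le] at hx
  exact ⟨hx.1, lt_of_not_ge fun hle => hx.2.not_ge (ENNReal.ofReal_le_ofReal hle)⟩

/-- Testing the modular inequality on `l · 1_B` with `B ⊆ {q < b}`, and bounding the maximal
function from below on a subset of `{a < p}` by the average over a cube containing both sets. -/
theorem rpow_mul_volume_le_of_modular {n : ℕ} {Ω A B : Set (Fin n → ℝ)} {p q : (Fin n → ℝ) → ℝ}
    {c₁ c₂ a b s l : ℝ} {z : Fin n → ℝ}
    (h : ∀ f : (Fin n → ℝ) → ℝ, Measurable f → ∫⁻ x in Ω, mxOn Ω f x ^ p x ≤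
      ENNReal.ofReal c₁ * (∫⁻ x in Ω, (‖f x‖₊ : ℝ≥0∞) ^ q x) + ENNReal.ofReal c₂)
    (ha : 0 ≤ a) (hs : 0 < s) (hl : 1 ≤ l)
    (hAmeas : MeasurableSet A) (hBmeas : MeasurableSet B) (hAΩ : A ⊆ Ω) (hBΩ : B ⊆ Ω)
    (hAQ : A ⊆ cube z s) (hBQ : B ⊆ cube z s) (hA : ∀ x ∈ A, a ≤ p x) (hB : ∀ x ∈ B, q x ≤ b)
    (hq : IsExponent Ω q) (hΩmeas : MeasurableSet Ω)
    (hav : 1 ≤ (volume (cube z s))⁻¹ * (ENNReal.ofReal l * volume B)) :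
    ((volume (cube z s))⁻¹ * (ENNReal.ofReal l * volume B)) ^ a * volume A ≤
      ENNReal.ofReal c₁ * (ENNReal.ofReal l ^ b * volume B) + ENNReal.ofReal c₂ := by
  set f : (Fin n → ℝ) → ℝ := B.indicator fun _ => l with hf
  have hl' : (‖l‖₊ : ℝ≥0∞) = ENNReal.ofReal l := by
    rw [← Real.enorm_of_nonneg (zero_le_one.trans hl)]
    rfl
  have hnorm : ∀ x, (‖f x‖₊ : ℝ≥0∞) = B.indicator (fun _ => ENNReal.ofReal l) x := by
    intro x
    by_cases hx : x ∈ B <;> simp [hf, hx, ← hl']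
  have hext : Ω.indicator f = f := by
    rw [hf, indicator_indicator, inter_eq_self_of_subset_right hBΩ]
  have hmx : ∀ x ∈ A, (volume (cube z s))⁻¹ * (ENNReal.ofReal l * volume B) ≤ mxOn Ω f x := by
    intro x hx
    rw [mxOn, hext]
    refine le_trans ?_ (average_le_mx f hs (hAQ hx))
    simp_rw [hnorm]
    rw [lintegral_indicator_const hBmeas, Measure.restrict_apply hBmeas,
      inter_eq_self_of_subset_left hBQ]
  calc ((volume (cube z s))⁻¹ * (ENNReal.ofReal l * volume B)) ^ a * volume A
      = ∫⁻ _ in A, ((volume (cube z s))⁻¹ * (ENNReal.ofReal l * volume B)) ^ a := by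
        rw [setLIntegral_const]
    _ ≤ ∫⁻ x in A, mxOn Ω f x ^ p x := by
        refine setLIntegral_mono' hAmeas fun x hx => ?_
        exact (ENNReal.rpow_le_rpow_of_exponent_le hav (hA x hx)).trans
          (ENNReal.rpow_le_rpow (hmx x hx) (ha.trans (hA x hx)))
    _ ≤ ∫⁻ x in Ω, mxOn Ω f x ^ p x := lintegral_mono_set hAΩ
    _ ≤ _ := h f (measurable_const.indicator hBmeas)
    _ ≤ ENNReal.ofReal c₁ * (∫⁻ x in Ω, B.indicator (fun _ => ENNReal.ofReal l ^ b) x) +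
          ENNReal.ofReal c₂ := by
        gcongr _ * ?_ + _
        refine setLIntegral_mono' hΩmeas fun x hx => ?_
        rw [hnorm]
        by_cases hxB : x ∈ B
        · rw [indicator_of_mem hxB, indicator_of_mem hxB]
          exact ENNReal.rpow_le_rpow_of_exponent_le (ENNReal.one_le_ofReal.2 hl) (hB x hxB)
        · rw [indicator_of_notMem hxB, indicator_of_notMem hxB,
            ENNReal.zero_rpow_of_pos (zero_lt_one.trans_le (hq.2 x hx))]
    _ ≤ _ := by
        rw [lintegral_indicator_const hBmeas]
        gcongr
        exact Measure.restrict_le_self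

theorem pSup_le_pInf_of_modIneq {n : ℕ} {Ω : Set (Fin n → ℝ)} (hΩmeas : MeasurableSet Ω)
    (hΩfin : volume Ω < ⊤) {p q : (Fin n → ℝ) → ℝ} (hp : IsExponent Ω p) (hq : IsExponent Ω q)
    {c₁ c₂ : ℝ} (hc₁ : 0 < c₁) (hc₂ : 0 ≤ c₂) (h : ModIneq Ω p q c₁ c₂) :
    pSup Ω p ≤ pInf Ω q := by
  by_contra! hlt
  have hmod : ∀ f : (Fin n → ℝ) → ℝ, Measurable f → ∫⁻ x in Ω, mxOn Ω f x ^ p x ≤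
      ENNReal.ofReal c₁ * (∫⁻ x in Ω, (‖f x‖₊ : ℝ≥0∞) ^ q x) +
        ENNReal.ofReal (c₁ * c₂ * (volume Ω).toReal) := fun f hf =>
    (h f hf).trans_eq (mul_setLIntegral_add_ofReal hΩfin _ hc₁.le hc₂)
  have hc : 0 ≤ c₁ * c₂ * (volume Ω).toReal := by positivity
  set c := c₁ * c₂ * (volume Ω).toReal
  obtain ⟨b, hqb, hbp⟩ := exists_between hlt
  obtain ⟨a, hba, hap⟩ := exists_between hbp
  lift a to NNReal using hap.ne_top
  lift b to NNReal using hba.ne_top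
  have hab : (b : ℝ) < a := by exact_mod_cast hba
  have hA0 := volume_setOf_lt_ne_zero_of_lt_pSup hΩmeas (a := a) (by simpa using hap)
  have hB0 := volume_setOf_lt_ne_zero_of_pInf_lt hΩmeas (b := b) (by simpa using hqb)
  obtain ⟨N₁, hN₁⟩ := exists_nat_volume_inter_cube_ne_zero hA0
  obtain ⟨N₂, hN₂⟩ := exists_nat_volume_inter_cube_ne_zero hB0
  set M : ℕ := N₁ + N₂ + 1 with hM
  set z : Fin n → ℝ := fun _ => -(M : ℝ)
  set s : ℝ := 2 * M
  have hs : 0 < s := by simp only [s, hM]; positivity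
  set A := Ω ∩ {x | (a : ℝ) < p x} ∩ cube z s
  set B := Ω ∩ {x | q x < b} ∩ cube z s
  have hApos : volume A ≠ 0 := hN₁ M (by omega)
  have hBpos : volume B ≠ 0 := hN₂ M (by omega)
  have hAtop : volume A ≠ ⊤ := measure_ne_top_of_subset inter_subset_right (volume_cube_ne_top z s)
  have hBtop : volume B ≠ ⊤ := measure_ne_top_of_subset inter_subset_right (volume_cube_ne_top z s)
  have hAmeas : MeasurableSet A := (hΩmeas.inter (measurableSet_lt measurable_const hp.1)).inter
    (isOpen_cube z s).measurableSet
  have hBmeas : MeasurableSet B := (hΩmeas.inter (measurableSet_lt hq.1 measurable_const)).inter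
    (isOpen_cube z s).measurableSet
  obtain ⟨α, hα⟩ : ∃ α, α = (volume A).toReal := ⟨_, rfl⟩
  obtain ⟨β, hβ⟩ : ∃ β, β = (volume B).toReal := ⟨_, rfl⟩
  obtain ⟨κ, hκ⟩ : ∃ κ, κ = (volume (cube z s)).toReal := ⟨_, rfl⟩
  have hα0 : 0 < α := hα ▸ ENNReal.toReal_pos hApos hAtop
  have hβ0 : 0 < β := hβ ▸ ENNReal.toReal_pos hBpos hBtop
  have hκ0 : 0 < κ := hκ ▸ ENNReal.toReal_pos (volume_cube_ne_zero z hs) (volume_cube_ne_top z s)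
  have hAα : volume A = ENNReal.ofReal α := by rw [hα, ENNReal.ofReal_toReal hAtop]
  have hBβ : volume B = ENNReal.ofReal β := by rw [hβ, ENNReal.ofReal_toReal hBtop]
  have hQκ : volume (cube z s) = ENNReal.ofReal κ := by
    rw [hκ, ENNReal.ofReal_toReal (volume_cube_ne_top z s)]
  have htest : ∀ l : ℝ, 1 ≤ l → κ / β ≤ l →
      (β / κ) ^ (a : ℝ) * α * l ^ ((a : ℝ) - b) ≤ c₁ * β + c := by
    intro l hl hl'
    have hl0 : 0 < l := zero_lt_one.trans_le hl
    have hav : (volume (cube z s))⁻¹ * (ENNReal.ofReal l * volume B) =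
        ENNReal.ofReal (β / κ * l) := by
      rw [hBβ, hQκ, ← ENNReal.ofReal_inv_of_pos hκ0, ← ENNReal.ofReal_mul hl0.le,
        ← ENNReal.ofReal_mul (by positivity)]
      congr 1
      ring
    have hav1 : 1 ≤ β / κ * l := by
      rw [div_le_iff₀ hβ0] at hl'
      rw [div_mul_eq_mul_div, one_le_div hκ0]
      linarith
    have key := rpow_mul_volume_le_of_modular (a := a) (b := b) hmod a.2 hs hl hAmeas hBmeas
      (fun x hx => hx.1.1) (fun x hx => hx.1.1) inter_subset_right inter_subset_right
      (fun x hx => hx.1.2.le) (fun x hx => hx.1.2.le) hq hΩmeas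
      (by rw [hav]; exact ENNReal.one_le_ofReal.2 hav1)
    rw [hav, hAα, hBβ, ENNReal.ofReal_rpow_of_pos (by positivity), ENNReal.ofReal_rpow_of_pos hl0,
      ← ENNReal.ofReal_mul (by positivity), ← ENNReal.ofReal_mul (by positivity),
      ← ENNReal.ofReal_mul hc₁.le, ← ENNReal.ofReal_add (by positivity) hc,
      ENNReal.ofReal_le_ofReal_iff (by positivity), Real.mul_rpow (by positivity) hl0.le] at key
    have hlb : 1 ≤ l ^ (b : ℝ) := Real.one_le_rpow hl b.2
    rw [Real.rpow_sub hl0, ← mul_div_assoc, div_le_iff₀ (zero_lt_one.trans_le hlb)]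
    nlinarith [mul_le_mul_of_nonneg_left hlb hc]
  have hlim : Filter.Tendsto (fun l : ℝ => (β / κ) ^ (a : ℝ) * α * l ^ ((a : ℝ) - b))
      Filter.atTop Filter.atTop :=
    (tendsto_rpow_atTop (sub_pos.2 hab)).const_mul_atTop (by positivity)
  obtain ⟨l, hl1, hl2, hl3⟩ := ((Filter.eventually_ge_atTop 1).and
    ((Filter.eventually_ge_atTop (κ / β)).and (hlim.eventually_gt_atTop (c₁ * β + c)))).exists
  exact (htest l hl1 hl2).not_gt hl3

/-- for `0 < |Ω| < ∞` and `p` not a.e. equal to `1` (i.e. `p₊(Ω) > 1`),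
the modular inequality holds for some constants `c₁ > 0`, `c₂ ≥ 0` iff `p₊(Ω) ≤ q₋(Ω)`. -/
theorem statement2 {n : ℕ} (hn : 0 < n) (Ω : Set (Fin n → ℝ)) (hΩmeas : MeasurableSet Ω)
    (hΩpos : 0 < volume Ω) (hΩfin : volume Ω < ⊤) (p q : (Fin n → ℝ) → ℝ)
    (hp : IsExponent Ω p) (hq : IsExponent Ω q) (hp1 : 1 < pSup Ω p) :
    (∃ c₁ c₂ : ℝ, 0 < c₁ ∧ 0 ≤ c₂ ∧ ModIneq Ω p q c₁ c₂) ↔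
      pSup Ω p ≤ pInf Ω q := by
  constructor
  · rintro ⟨c₁, c₂, hc₁, hc₂, h⟩
    exact pSup_le_pInf_of_modIneq hΩmeas hΩfin hp hq hc₁ hc₂ h
  · exact exists_modIneq_of_pSup_le_pInf hn hΩmeas hΩpos hΩfin hp hq hp1
end
end

section
/- Let Ω ⊆ ℝⁿ be a Lebesgue measurable set with |Ω| = ∞ and let p(·), q(·) ∈ 𝒫(Ω) with p₊(Ω) < ∞. Suppose p(·) and q(·) touch at infinity, suppose the set D = {x ∈ Ω : p(x) < q(x)} is nonempty, and suppose there exists λ > 1 such that ∫_D λ^{−r(x)} dx < ∞, where r(·) is the defect exponent defined on D by 1/r(x) = 1/p(x) − 1/q(x). Then there exists a measurable function ω on D with 0 < ω(x) ≤ 1 for all x ∈ D such that ∫_D ω(x)^{p(x)} dx < ∞, ess sup_{x ∈ D} ω(x)^{−|p₊(Ω) − p(x)|} < ∞, and ess sup_{x ∈ D} ω(x)^{−|q(x) − p₊(Ω)|} < ∞. -/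
open MeasureTheory Set ENNReal

noncomputable section

/-- Raising the weight `lam ^ (-(b / (b - a)))` to the power `a` gives `lam ^ (-r)`, where
`1 / r = 1 / a - 1 / b`. -/
lemma rpow_neg_div_sub_rpow {lam a b : ℝ} (hlam : 0 ≤ lam) (ha : 0 < a) (hab : a < b) :
    (lam ^ (-(b / (b - a)))) ^ a = lam ^ (-((a⁻¹ - b⁻¹)⁻¹)) := by
  rw [← Real.rpow_mul hlam]
  congr 1
  have hb : b ≠ 0 := (ha.trans hab).ne'
  have hba : b - a ≠ 0 := (sub_pos.2 hab).ne'
  rw [inv_sub_inv ha.ne' hb, inv_div]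
  field_simp

/-- The weight `lam ^ (-(b / (b - a)))` loses at most the factor `lam ^ b` when raised to the
power `-t` with `t ≤ b - a`. -/
lemma rpow_neg_div_sub_rpow_neg_le {lam a b t : ℝ} (hlam : 1 ≤ lam) (hb : 0 ≤ b) (hab : a < b)
    (ht : t ≤ b - a) : (lam ^ (-(b / (b - a)))) ^ (-t) ≤ lam ^ b := by
  rw [← Real.rpow_mul (zero_le_one.trans hlam)]
  apply Real.rpow_le_rpow_of_exponent_le hlam
  have hba : 0 < b - a := sub_pos.2 hab
  rw [neg_mul_neg, div_mul_eq_mul_div, div_le_iff₀ hba]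
  exact mul_le_mul_of_nonneg_left ht hb

/-- If `p` and `q` touch at infinity, then `q` exceeds `p₊(Ω) + 1` only on a set of finite
measure. -/
lemma TouchAtInfinity.volume_lt_top {n : ℕ} {Ω : Set (Fin n → ℝ)} {p q : (Fin n → ℝ) → ℝ}
    (htouch : TouchAtInfinity Ω p q) (hΩ : MeasurableSet Ω) (hq : Measurable q)
    (hpfin : pSup Ω p < ⊤) :
    volume {x ∈ Ω | (pSup Ω p).toReal + 1 < q x} < ⊤ := by
  set P := (pSup Ω p).toReal
  have hE : MeasurableSet {x ∈ Ω | P + 1 < q x} :=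
    hΩ.inter (measurableSet_lt measurable_const hq)
  by_contra hinf
  obtain ⟨-, h₂, h₃⟩ := htouch _ hE (fun x hx => hx.1) (not_lt_top_iff.1 hinf)
  have hle : ENNReal.ofReal (P + 1) ≤ pInf {x ∈ Ω | P + 1 < q x} q := by
    refine le_essInf_of_ae_le _ ?_
    filter_upwards [ae_restrict_mem hE] with x hx
    exact ENNReal.ofReal_le_ofReal hx.2.le
  rw [← h₃, ← h₂, ENNReal.ofReal_le_iff_le_toReal hpfin.ne] at hle
  linarith

/-- If `p` and `q` touch at infinity, then `p ≤ p₊(Ω) ≤ q` almost everywhere on `Ω`. -/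
lemma TouchAtInfinity.ae_le_and_le {n : ℕ} {Ω : Set (Fin n → ℝ)} {p q : (Fin n → ℝ) → ℝ}
    (htouch : TouchAtInfinity Ω p q) (hΩ : MeasurableSet Ω) (hΩinf : volume Ω = ⊤)
    (hq : ∀ x ∈ Ω, 0 ≤ q x) (hpfin : pSup Ω p < ⊤) :
    ∀ᵐ x ∂volume.restrict Ω, p x ≤ (pSup Ω p).toReal ∧ (pSup Ω p).toReal ≤ q x := by
  obtain ⟨-, h, -⟩ := htouch Ω hΩ Subset.rfl hΩinf
  filter_upwards [ae_restrict_mem hΩ,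
    _root_.ae_le_essSup (μ := volume.restrict Ω) (f := fun x => ENNReal.ofReal (p x)),
    ae_essInf_le (μ := volume.restrict Ω) (f := fun x => ENNReal.ofReal (q x))] with x hx h₁ h₂
  refine ⟨(ENNReal.ofReal_le_iff_le_toReal hpfin.ne).1 h₁, ?_⟩
  refine ENNReal.toReal_le_of_le_ofReal (hq x hx) ?_
  rw [h]
  exact h₂

/-- A real function that is almost everywhere bounded by a constant has finite essential
supremum. -/
lemma essSup_ofReal_lt_top {α : Type*} [MeasurableSpace α] {μ : Measure α} {f : α → ℝ} {C : ℝ}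
    (h : ∀ᵐ x ∂μ, f x ≤ C) : essSup (fun x => ENNReal.ofReal (f x)) μ < ⊤ :=
  (essSup_le_of_ae_le (ENNReal.ofReal C)
    (h.mono fun _ hx => ENNReal.ofReal_le_ofReal hx)).trans_lt ENNReal.ofReal_lt_top

/-- construction of the weight `ω`. If `|Ω| = ∞`, `p₊(Ω) < ∞`, `p` and `q`
touch at infinity, `D = {p < q}` is nonempty, and `∫_D λ^{-r(x)} dx < ∞` for some `λ > 1`
(`1/r = 1/p - 1/q`), then there is a measurable `ω` with `0 < ω ≤ 1` on `D`,
`∫_D ω^{p(x)} < ∞`, and `ω^{-|p₊ - p(·)|}`, `ω^{-|q(·) - p₊|}` essentially bounded on `D`. -/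
theorem statement9 {n : ℕ} (hn : 0 < n) (Ω : Set (Fin n → ℝ)) (hΩmeas : MeasurableSet Ω)
    (hΩinf : volume Ω = ⊤) (p q : (Fin n → ℝ) → ℝ)
    (hp : IsExponent Ω p) (hq : IsExponent Ω q) (hpfin : pSup Ω p < ⊤)
    (htouch : TouchAtInfinity Ω p q)
    (D : Set (Fin n → ℝ)) (hDdef : D = {x ∈ Ω | p x < q x}) (hD : D.Nonempty)
    (hlam : ∃ lam : ℝ, 1 < lam ∧
      (∫⁻ x in D, ENNReal.ofReal (lam ^ (-(((p x)⁻¹ - (q x)⁻¹)⁻¹)))) < ⊤) :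
    ∃ ω : (Fin n → ℝ) → ℝ, Measurable ω ∧ (∀ x ∈ D, 0 < ω x ∧ ω x ≤ 1) ∧
      (∫⁻ x in D, ENNReal.ofReal (ω x ^ (p x))) < ⊤ ∧
      essSup (fun x => ENNReal.ofReal (ω x ^ (-|(pSup Ω p).toReal - p x|)))
        (volume.restrict D) < ⊤ ∧
      essSup (fun x => ENNReal.ofReal (ω x ^ (-|q x - (pSup Ω p).toReal|)))
        (volume.restrict D) < ⊤ := by
  obtain ⟨lam, hlam1, hint⟩ := hlam
  have hlam0 : 0 < lam := zero_lt_one.trans hlam1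
  have hfar := htouch.volume_lt_top hΩmeas hq.1 hpfin
  have hae := htouch.ae_le_and_le hΩmeas hΩinf (fun x hx => zero_le_one.trans (hq.2 x hx)) hpfin
  set P := (pSup Ω p).toReal
  have hDmeas : MeasurableSet D := hDdef ▸ hΩmeas.inter (measurableSet_lt hp.1 hq.1)
  have hDsub : D ⊆ Ω := hDdef ▸ fun x hx => hx.1
  have hlt : ∀ x ∈ D, p x < q x := by
    rw [hDdef]
    exact fun x hx => hx.2
  have hEmeas : MeasurableSet {x ∈ Ω | P + 1 < q x} :=
    hΩmeas.inter (measurableSet_lt measurable_const hq.1)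
  have haeD := ae_restrict_of_ae_restrict_of_subset hDsub hae
  -- Where `q` is large, a set of finite measure, the weight is simply `1`.
  let ω : (Fin n → ℝ) → ℝ := fun x => if q x ≤ P + 1 then lam ^ (-(q x / (q x - p x))) else 1
  have hω : ∀ x, ω x = if q x ≤ P + 1 then lam ^ (-(q x / (q x - p x))) else 1 := fun _ => rfl
  have hbound : ∀ x ∈ D, ∀ t ≤ q x - p x, ω x ^ (-t) ≤ lam ^ (P + 1) := by
    intro x hx t ht
    rw [hω]
    split_ifs with h
    · exact (rpow_neg_div_sub_rpow_neg_le hlam1.le (zero_le_one.trans (hq.2 x (hDsub hx)))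
        (hlt x hx) ht).trans (Real.rpow_le_rpow_of_exponent_le hlam1.le h)
    · rw [Real.one_rpow]
      exact Real.one_le_rpow hlam1.le (add_nonneg ENNReal.toReal_nonneg zero_le_one)
  refine ⟨ω, ?_, ?_, ?_, essSup_ofReal_lt_top (C := lam ^ (P + 1)) ?_,
    essSup_ofReal_lt_top (C := lam ^ (P + 1)) ?_⟩
  · exact Measurable.ite (measurableSet_le hq.1 measurable_const)
      (measurable_const.pow (hq.1.div (hq.1.sub hp.1)).neg) measurable_const
  · intro x hx
    rw [hω]
    split_ifs with h
    · refine ⟨Real.rpow_pos_of_pos hlam0 _, Real.rpow_le_one_of_one_le_of_nonpos hlam1.le ?_⟩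
      exact neg_nonpos.2 (div_nonneg (zero_le_one.trans (hq.2 x (hDsub hx)))
        (sub_pos.2 (hlt x hx)).le)
    · exact ⟨zero_lt_one, le_rfl⟩
  · calc ∫⁻ x in D, ENNReal.ofReal (ω x ^ p x)
        ≤ ∫⁻ x in D, (ENNReal.ofReal (lam ^ (-(((p x)⁻¹ - (q x)⁻¹)⁻¹))) +
            {x ∈ Ω | P + 1 < q x}.indicator 1 x) := by
          refine setLIntegral_mono' hDmeas fun x hx => ?_
          rw [hω]
          split_ifs with h
          · rw [rpow_neg_div_sub_rpow hlam0.le (zero_lt_one.trans_le (hp.2 x (hDsub hx)))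
              (hlt x hx)]
            exact le_self_add
          · rw [Real.one_rpow, ENNReal.ofReal_one,
              indicator_of_mem (show x ∈ {x ∈ Ω | P + 1 < q x} from ⟨hDsub hx, not_le.1 h⟩)]
            exact le_add_self
      _ = (∫⁻ x in D, ENNReal.ofReal (lam ^ (-(((p x)⁻¹ - (q x)⁻¹)⁻¹)))) +
            volume.restrict D {x ∈ Ω | P + 1 < q x} := by
          rw [lintegral_add_right _ (measurable_one.indicator hEmeas),
            lintegral_indicator_one hEmeas]
      _ < ⊤ := ENNReal.add_lt_top.2 ⟨hint, (Measure.restrict_apply_le _ _).trans_lt hfar⟩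
  · filter_upwards [ae_restrict_mem hDmeas, haeD] with x hx hPx
    refine hbound x hx _ ?_
    rw [abs_of_nonneg (sub_nonneg.2 hPx.1)]
    linarith [hPx.2]
  · filter_upwards [ae_restrict_mem hDmeas, haeD] with x hx hPx
    refine hbound x hx _ ?_
    rw [abs_of_nonneg (sub_nonneg.2 hPx.2)]
    linarith [hPx.1]
end
end

section
/- Let Ω ⊆ ℝⁿ be a Lebesgue measurable set with 0 < |Ω| < ∞, let p(·), q(·) ∈ 𝒫(Ω) with p₊(Ω) > 1 and p₊(Ω) ≤ q₋(Ω), and let T be a map from measurable functions on Ω to measurable functions on Ω for which there is a constant C > 0 with ∫_Ω |Tf(x)|^{p₊} dx ≤ C ∫_Ω |f(x)|^{p₊} dx for every measurable f. Then there exist constants c₁ > 0 and c₂ ≥ 0, independent of f, such that ∫_Ω |Tf(x)|^{p(x)} dx ≤ c₁ ∫_Ω |f(x)|^{q(x)} dx + c₂ for every measurable function f on Ω. -/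
open MeasureTheory Set ENNReal

noncomputable section

/-- Raising to a smaller nonnegative power costs at most an additive `1`. -/
theorem ENNReal.rpow_le_rpow_add_one (a : ℝ≥0∞) {r s : ℝ} (hr : 0 ≤ r) (hrs : r ≤ s) :
    a ^ r ≤ a ^ s + 1 := by
  rcases le_total a 1 with ha | ha
  · exact (ENNReal.rpow_le_one ha hr).trans le_add_self
  · exact (ENNReal.rpow_le_rpow_of_exponent_le ha hrs).trans le_self_add

/-- A modular of a smaller exponent is controlled by that of a larger one, up to the measure
of the set. -/
theorem lintegral_rpow_le_add_volume {n : ℕ} {Ω : Set (Fin n → ℝ)}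
    {r s : (Fin n → ℝ) → ℝ} (hr : ∀ᵐ x ∂volume.restrict Ω, 0 ≤ r x)
    (hrs : ∀ᵐ x ∂volume.restrict Ω, r x ≤ s x) (g : (Fin n → ℝ) → ℝ≥0∞) :
    ∫⁻ x in Ω, g x ^ r x ≤ (∫⁻ x in Ω, g x ^ s x) + volume Ω := by
  calc ∫⁻ x in Ω, g x ^ r x ≤ ∫⁻ x in Ω, (g x ^ s x + 1) := by
        apply lintegral_mono_ae
        filter_upwards [hr, hrs] with x h0 h1
        exact ENNReal.rpow_le_rpow_add_one _ h0 h1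
    _ = (∫⁻ x in Ω, g x ^ s x) + volume Ω := by
        rw [lintegral_add_right _ measurable_const]
        simp

/-- The essential infimum of a real-valued exponent over a non-null set is finite. -/
theorem pInf_lt_top {n : ℕ} {E : Set (Fin n → ℝ)} (hE : 0 < volume E)
    (q : (Fin n → ℝ) → ℝ) : pInf E q < ⊤ := by
  have : NeZero (volume.restrict E) := ⟨by simpa using hE.ne'⟩
  obtain ⟨x, hx⟩ := (ae_essInf_le (f := fun x => ENNReal.ofReal (q x))
    (μ := volume.restrict E)).exists
  exact hx.trans_lt ENNReal.ofReal_lt_top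

/-- modular inequalities for `L^{p₊}`-bounded operators on sets of finite
measure. If `0 < |Ω| < ∞`, `p₊(Ω) > 1`, `p₊(Ω) ≤ q₋(Ω)`, and `T` maps measurable functions
to measurable functions with `∫_Ω |Tf|^{p₊} ≤ C ∫_Ω |f|^{p₊}`, then
`∫_Ω |Tf(x)|^{p(x)} dx ≤ c₁ ∫_Ω |f(x)|^{q(x)} dx + c₂` for some `c₁ > 0, c₂ ≥ 0`. -/
theorem statement16 {n : ℕ} (hn : 0 < n) (Ω : Set (Fin n → ℝ)) (hΩmeas : MeasurableSet Ω)
    (hΩpos : 0 < volume Ω) (hΩfin : volume Ω < ⊤) (p q : (Fin n → ℝ) → ℝ)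
    (hp : IsExponent Ω p) (hq : IsExponent Ω q)
    (hp1 : 1 < pSup Ω p) (hpq : pSup Ω p ≤ pInf Ω q)
    (T : ((Fin n → ℝ) → ℝ) → ((Fin n → ℝ) → ℝ))
    (hTmeas : ∀ f, Measurable f → Measurable (T f))
    (C : ℝ) (hC : 0 < C)
    (hT : ∀ f : (Fin n → ℝ) → ℝ, Measurable f →
      ∫⁻ x in Ω, (‖T f x‖₊ : ℝ≥0∞) ^ (pSup Ω p).toReal ≤
        ENNReal.ofReal C * ∫⁻ x in Ω, (‖f x‖₊ : ℝ≥0∞) ^ (pSup Ω p).toReal) :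
    ∃ c₁ c₂ : ℝ, 0 < c₁ ∧ 0 ≤ c₂ ∧ ∀ f : (Fin n → ℝ) → ℝ, Measurable f →
      ∫⁻ x in Ω, (‖T f x‖₊ : ℝ≥0∞) ^ (p x) ≤
        ENNReal.ofReal c₁ * ∫⁻ x in Ω, (‖f x‖₊ : ℝ≥0∞) ^ (q x) + ENNReal.ofReal c₂ := by
  set P := (pSup Ω p).toReal
  have hPtop : pSup Ω p ≠ ⊤ := (hpq.trans_lt (pInf_lt_top hΩpos q)).ne
  have hp0 : ∀ᵐ x ∂volume.restrict Ω, 0 ≤ p x := by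
    filter_upwards [ae_restrict_mem hΩmeas] with x hx
    exact zero_le_one.trans (hp.2 x hx)
  have hpP : ∀ᵐ x ∂volume.restrict Ω, p x ≤ P := by
    filter_upwards [ENNReal.ae_le_essSup (μ := volume.restrict Ω)
      fun x => ENNReal.ofReal (p x)] with x hx
    exact (ENNReal.ofReal_le_iff_le_toReal hPtop).1 hx
  have hPq : ∀ᵐ x ∂volume.restrict Ω, P ≤ q x := by
    filter_upwards [ae_essInf_le (f := fun x => ENNReal.ofReal (q x)) (μ := volume.restrict Ω),
      ae_restrict_mem hΩmeas] with x hx hxΩ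
    exact ENNReal.toReal_le_of_le_ofReal (zero_le_one.trans (hq.2 x hxΩ)) (hpq.trans hx)
  -- The additive constant is integrated over `Ω` and multiplied by `c₁` in the goal.
  refine ⟨C, 1 + C⁻¹, hC, by positivity, fun f hf => ?_⟩
  have hconst : ENNReal.ofReal C * ENNReal.ofReal (1 + C⁻¹) = ENNReal.ofReal C + 1 := by
    rw [← ENNReal.ofReal_mul hC.le, mul_add, mul_one, mul_inv_cancel₀ hC.ne',
      ENNReal.ofReal_add hC.le zero_le_one, ENNReal.ofReal_one]
  rw [lintegral_add_right _ measurable_const, setLIntegral_const, mul_add, ← mul_assoc, hconst]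
  calc ∫⁻ x in Ω, (‖T f x‖₊ : ℝ≥0∞) ^ (p x)
      ≤ (∫⁻ x in Ω, (‖T f x‖₊ : ℝ≥0∞) ^ P) + volume Ω :=
        lintegral_rpow_le_add_volume hp0 hpP _
    _ ≤ ENNReal.ofReal C * (∫⁻ x in Ω, (‖f x‖₊ : ℝ≥0∞) ^ P) + volume Ω := by
        gcongr
        exact hT f hf
    _ ≤ ENNReal.ofReal C * ((∫⁻ x in Ω, (‖f x‖₊ : ℝ≥0∞) ^ (q x)) + volume Ω)
          + volume Ω := by
        gcongr
        exact lintegral_rpow_le_add_volume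
          (Filter.Eventually.of_forall fun _ => ENNReal.toReal_nonneg) hPq _
    _ = ENNReal.ofReal C * (∫⁻ x in Ω, (‖f x‖₊ : ℝ≥0∞) ^ (q x))
          + (ENNReal.ofReal C + 1) * volume Ω := by
        ring
end
end
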